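/- arXiv:1210.6256 — 2 statements merged into one kernel-verified Lean document; each statement's English description precedes it below -/
import Mathlib

section
/- Let K be a nondegenerate tetrahedron in ℝ³ and let τ ∈ P₂(K; 𝕊) be a quadratic symmetric-matrix-valued polynomial field with div τ = 0 on K. If ∫_{∂K} τ n · v ds = 0 for every affine vector field v ∈ P₁(K; ℝ³) (where n is the outward unit normal of K), then ∫_K τ dx = 0 (entrywise). -/
open MeasureTheory RealInnerProductSpace Matrix

noncomputable section

abbrev E3 := EuclideanSpace ℝ (Fin 3)

/-- `p` is (the restriction of) a real polynomial of total degree ≤ k on ℝ³. -/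
def IsPolyLE (k : ℕ) (p : E3 → ℝ) : Prop :=
  ∃ P : MvPolynomial (Fin 3) ℝ, P.totalDegree ≤ k ∧ ∀ x, p x = MvPolynomial.eval (fun i => x i) P

/-- `p` agrees with an affine function on the set `s`. -/
def AffineOn (s : Set E3) (p : E3 → ℝ) : Prop :=
  ∃ q : E3 →ᵃ[ℝ] ℝ, ∀ x ∈ s, p x = q x

def Tet (v : Fin 4 → E3) : Set E3 := convexHull ℝ (Set.range v)

def Face (v : Fin 4 → E3) (i : Fin 4) : Set E3 := convexHull ℝ (v '' {j | j ≠ i})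

def Edge (v : Fin 4 → E3) (k l : Fin 4) : Set E3 := segment ℝ (v k) (v l)

/-- The matrix of the orthogonal projection `Q_u = I - u uᵀ` onto the plane `u^⊥`. -/
def Qmat (u : E3) : Matrix (Fin 3) (Fin 3) ℝ :=
  1 - Matrix.vecMulVec (fun i => u i) (fun i => u i)


/-- `n` is the outward unit normal to the face of the tetrahedron with vertices `v`
opposite the vertex `v i`. -/
def IsOutwardNormal (v : Fin 4 → E3) (i : Fin 4) (n : E3) : Prop :=
  ‖n‖ = 1 ∧ (∀ j k : Fin 4, j ≠ i → k ≠ i → ⟪v j - v k, n⟫ = 0) ∧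
  (∀ j : Fin 4, j ≠ i → ⟪v i - v j, n⟫ < 0)

/-- The row-wise divergence of a matrix field. -/
def divRow (τ : E3 → Matrix (Fin 3) (Fin 3) ℝ) (r : Fin 3) (x : E3) : ℝ :=
  ∑ m : Fin 3, fderiv ℝ (fun y => τ y r m) x (EuclideanSpace.single m 1)


open MeasureTheory.Measure in
lemma int_image (d : ℕ) (f : EuclideanSpace ℝ (Fin d) →ₗ[ℝ] E3) (hf : Function.Injective f)
    (p : E3) (S : Set (Fin d → ℝ)) (hS : MeasurableSet S) (g : E3 → ℝ) :
    ∫ x in (fun s => p + f (WithLp.toLp 2 s)) '' S, g x ∂μHE[d]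
      = f.normDet * ∫ s in S, g (p + f (WithLp.toLp 2 s)) := by
  set φ : EuclideanSpace ℝ (Fin d) → E3 := fun x => p + f x with hφ
  have hfc : Continuous f := f.continuous_of_finiteDimensional
  have hφc : Continuous φ := continuous_const.add hfc
  have hφi : Function.Injective φ := fun x y h => hf (add_left_cancel h)
  have hemb : MeasurableEmbedding φ := hφc.measurableEmbedding hφi
  have hmap : (μHE[d] : Measure E3).restrict (Set.range φ)
      = ENNReal.ofReal f.normDet • Measure.map φ volume := by
    ext A hA
    rw [Measure.restrict_apply hA, Measure.smul_apply, hemb.map_apply,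
      ← Set.image_preimage_eq_inter_range]
    have h1 := f.euclideanHausdorffMeasure_image_eq_normDet_mul_volume (φ ⁻¹' A)
    rw [finrank_euclideanSpace, Fintype.card_fin] at h1
    rw [smul_eq_mul, ← h1]
    have : φ '' (φ ⁻¹' A) = (IsometryEquiv.addLeft p) '' (f '' (φ ⁻¹' A)) := by
      rw [Set.image_image]; rfl
    rw [this]
    exact (IsometryEquiv.addLeft p).isometry.euclideanHausdorffMeasure_image _
  have hmp := PiLp.volume_preserving_toLp (Fin d)
  have hme : MeasurableEmbedding (WithLp.toLp 2 : (Fin d → ℝ) → EuclideanSpace ℝ (Fin d)) :=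
    (MeasurableEquiv.toLp 2 (Fin d → ℝ)).measurableEmbedding
  have him : (fun s => p + f (WithLp.toLp 2 s)) '' S = φ '' (WithLp.toLp 2 '' S) := by
    rw [Set.image_image]
  have hms : MeasurableSet (WithLp.toLp 2 '' S : Set (EuclideanSpace ℝ (Fin d))) :=
    hme.measurableSet_image.2 hS
  have hms2 : MeasurableSet (φ '' (WithLp.toLp 2 '' S)) := hemb.measurableSet_image.2 hms
  rw [him, ← Set.inter_eq_left.2 (Set.image_subset_range φ (WithLp.toLp 2 '' S)),
    ← Measure.restrict_restrict hms2, hmap, Measure.restrict_smul, integral_smul_measure,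
    hemb.setIntegral_map, hφi.preimage_image, ENNReal.toReal_ofReal f.normDet_nonneg,
    smul_eq_mul, hmp.setIntegral_image_emb hme]

/-- The reference simplex. -/
def TT (d : ℕ) : Set (Fin d → ℝ) := {s | (∀ i, 0 ≤ s i) ∧ ∑ i, s i ≤ 1}

/-- The linear part of the parametrization of a simplex. -/
def linP {d : ℕ} (q : Fin (d + 1) → E3) : EuclideanSpace ℝ (Fin d) →ₗ[ℝ] E3 :=
  (EuclideanSpace.basisFun (Fin d) ℝ).toBasis.constr ℝ (fun i => q i.succ - q 0)

lemma linP_apply {d : ℕ} (q : Fin (d + 1) → E3) (s : Fin d → ℝ) :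
    linP q (WithLp.toLp 2 s) = ∑ i, s i • (q i.succ - q 0) := by
  simp [linP, Module.Basis.constr_apply_fintype]

lemma linP_inj {d : ℕ} (q : Fin (d + 1) → E3) (hq : AffineIndependent ℝ q) :
    Function.Injective (linP q) := by
  have h := (affineIndependent_iff_linearIndependent_vsub ℝ q 0).1 hq
  have h2 : LinearIndependent ℝ (fun i : Fin d => q i.succ - q 0) :=
    h.comp (fun i : Fin d => (⟨i.succ, Fin.succ_ne_zero i⟩ : {x : Fin (d+1) // x ≠ 0}))
      (fun i j hij => by simpa using hij)
  rw [injective_iff_map_eq_zero]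
  intro x hx
  have hx2 : ∑ i, x.ofLp i • (q i.succ - q 0) = 0 := by
    rw [← linP_apply]; exact hx
  ext i
  exact Fintype.linearIndependent_iff.1 h2 _ hx2 i

lemma normDet_linP {d : ℕ} (q : Fin (d + 1) → E3) :
    (linP q).normDet ^ 2 = (Matrix.of fun i j : Fin d => ⟪q i.succ - q 0, q j.succ - q 0⟫).det := by
  have := (linP q).normDet_sq_eq_det_gram (EuclideanSpace.basisFun (Fin d) ℝ)
  rw [show ((linP q).normDet ^ 2) = (((linP q).normDet ^ 2 : ℝ) : ℝ) from rfl]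
  refine this.trans ?_
  congr 1
  ext i j
  simp [Matrix.gram, linP]

lemma hull_eq {d : ℕ} (q : Fin (d + 1) → E3) :
    convexHull ℝ (Set.range q) = (fun s => q 0 + linP q (WithLp.toLp 2 s)) '' TT d := by
  ext x
  constructor
  · intro hx
    refine convexHull_min ?_ ?_ hx
    · rintro _ ⟨i, rfl⟩
      refine Fin.cases ?_ ?_ i
      · exact ⟨0, ⟨fun _ => le_rfl, by simp⟩, by simp⟩
      · intro j
        refine ⟨Pi.single j 1, ⟨fun k => ?_, by simp⟩, ?_⟩
        · by_cases h : k = j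
          · subst h; simp
          · simp [h]
        · simp only [linP_apply]
          simp [Pi.single_apply]
    · have : (fun s => q 0 + linP q (WithLp.toLp 2 s)) '' TT d
          = (fun y => q 0 + y) '' ((linP q ∘ₗ (WithLp.linearEquiv 2 ℝ (Fin d → ℝ)).symm.toLinearMap) '' TT d) := by
        rw [Set.image_image]; rfl
      rw [this]
      refine (Convex.linear_image ?_ _).translate _
      intro s hs t ht a b ha hb hab
      refine ⟨fun i => ?_, ?_⟩
      · have := mul_nonneg ha (hs.1 i)
        have := mul_nonneg hb (ht.1 i)
        simp only [Pi.add_apply, Pi.smul_apply, smul_eq_mul]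
        linarith
      · simp only [Pi.add_apply, Pi.smul_apply, smul_eq_mul, Finset.sum_add_distrib,
          ← Finset.mul_sum]
        have := mul_le_mul_of_nonneg_left hs.2 ha
        have := mul_le_mul_of_nonneg_left ht.2 hb
        linarith
  · rintro ⟨s, hs, rfl⟩
    refine mem_convexHull_of_exists_fintype (Fin.cons (1 - ∑ i, s i) s) q ?_ ?_ (by simp) ?_
    · intro i
      refine Fin.cases ?_ ?_ i
      · simpa using hs.2
      · simpa using hs.1
    · simp [Fin.sum_univ_succ]
    · simp only [Fin.sum_univ_succ, Fin.cons_zero, Fin.cons_succ, linP_apply, smul_sub,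
        Finset.sum_sub_distrib, ← Finset.sum_smul, sub_smul, one_smul]
      abel

lemma TT_closed (d : ℕ) : IsClosed (TT d) := by
  apply IsClosed.inter (s₁ := {s : Fin d → ℝ | ∀ i, 0 ≤ s i}) (s₂ := {s | ∑ i, s i ≤ 1})
  · simp only [Set.ofPred_forall]
    exact isClosed_iInter fun i => isClosed_le continuous_const (continuous_apply i)
  · exact isClosed_le (by fun_prop) continuous_const

lemma TT_compact (d : ℕ) : IsCompact (TT d) := by
  refine IsCompact.of_isClosed_subset (isCompact_univ_pi (fun _ : Fin d => isCompact_Icc (a := (0:ℝ)) (b := 1)))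
    (TT_closed d) ?_
  intro s hs i _
  refine ⟨hs.1 i, ?_⟩
  exact (Finset.single_le_sum (fun j _ => hs.1 j) (Finset.mem_univ i)).trans hs.2

open MeasureTheory.Measure in
lemma simplex_int {d : ℕ} (q : Fin (d + 1) → E3) (hq : AffineIndependent ℝ q) (g : E3 → ℝ) :
    ∫ x in convexHull ℝ (Set.range q), g x ∂μHE[d] =
      (linP q).normDet * ∫ s in TT d, g (q 0 + ∑ i, s i • (q i.succ - q 0)) := by
  rw [hull_eq, int_image d _ (linP_inj q hq) _ _ (TT_closed d).measurableSet]
  simp only [linP_apply]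

/-- Fubini and the fundamental theorem of calculus on the reference simplex. -/
lemma ref_int (G G' : (Fin 3 → ℝ) → ℝ) (hG' : Continuous G')
    (hd : ∀ r s, HasDerivAt (fun r => G (Fin.cons r s)) (G' (Fin.cons r s)) r) :
    ∫ t in TT 3, G' t = ∫ s in TT 2, (G (Fin.cons (1 - ∑ i, s i) s) - G (Fin.cons 0 s)) := by
  have hmp := (volume_preserving_piFinSuccAbove (fun _ : Fin 3 => ℝ) 0).symm
  have hint : Integrable ((TT 3).indicator G') := by
    rw [integrable_indicator_iff (TT_closed 3).measurableSet]
    exact hG'.continuousOn.integrableOn_compact (TT_compact 3)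
  have hcons : ∀ x : ℝ × (Fin 2 → ℝ), (MeasurableEquiv.piFinSuccAbove (fun _ : Fin 3 => ℝ) 0).symm x
      = Fin.cons x.1 x.2 := by
    intro x
    simp [MeasurableEquiv.piFinSuccAbove_symm_apply]
    rfl
  rw [← integral_indicator (TT_closed 3).measurableSet, ← hmp.integral_comp',
    ← integral_indicator (TT_closed 2).measurableSet]
  have hint2 := (hmp.integrable_comp_emb (MeasurableEquiv.measurableEmbedding _)).2 hint
  rw [Measure.volume_eq_prod, integral_prod_symm]
  swap
  · exact hint2
  congr 1
  ext s
  simp only [hcons]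
  by_cases hs : s ∈ TT 2
  · rw [Set.indicator_of_mem hs]
    have h1 : (fun r : ℝ => (TT 3).indicator G' (Fin.cons r s)) =
        (Set.Icc 0 (1 - ∑ i, s i)).indicator (fun r => G' (Fin.cons r s)) := by
      ext r
      have : (Fin.cons r s : Fin 3 → ℝ) ∈ TT 3 ↔ r ∈ Set.Icc 0 (1 - ∑ i, s i) := by
        constructor
        · rintro ⟨h1, h2⟩
          refine ⟨by simpa using h1 0, ?_⟩
          rw [Fin.sum_univ_succ] at h2
          simp only [Fin.cons_zero, Fin.cons_succ] at h2
          linarith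
        · rintro ⟨h1, h2⟩
          refine ⟨fun i => ?_, ?_⟩
          · refine Fin.cases ?_ (fun j => ?_) i
            · exact h1
            · exact hs.1 j
          · rw [Fin.sum_univ_succ]
            simp only [Fin.cons_zero, Fin.cons_succ]
            linarith
      by_cases hr : r ∈ Set.Icc 0 (1 - ∑ i, s i)
      · rw [Set.indicator_of_mem hr, Set.indicator_of_mem (this.2 hr)]
      · rw [Set.indicator_of_notMem hr, Set.indicator_of_notMem (fun h => hr (this.1 h))]
    rw [h1, integral_indicator measurableSet_Icc, integral_Icc_eq_integral_Ioc,
      ← intervalIntegral.integral_of_le (by linarith [hs.2])]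
    refine intervalIntegral.integral_eq_sub_of_hasDerivAt (fun r _ => hd r s) ?_
    refine Continuous.intervalIntegrable ?_ _ _
    refine hG'.comp (continuous_pi fun i => ?_)
    refine Fin.cases ?_ ?_ i
    · exact continuous_id
    · intro j; simpa using continuous_const
  · rw [Set.indicator_of_notMem hs]
    have : ∀ r : ℝ, (TT 3).indicator G' (Fin.cons r s) = 0 := by
      intro r
      apply Set.indicator_of_notMem
      rintro ⟨h1, h2⟩
      apply hs
      refine ⟨fun i => by simpa using h1 i.succ, ?_⟩
      rw [Fin.sum_univ_succ] at h2
      have := h1 0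
      simp only [Fin.cons_zero, Fin.cons_succ] at h2 this
      linarith
    simp [this]

lemma gram_three (u a b n : E3) (ha : ⟪a, n⟫ = 0) (hb : ⟪b, n⟫ = 0) (hn : ‖n‖ = 1)
    (e : Fin 3 → E3) (he0 : e 0 = u) (he1 : e 1 = a) (he2 : e 2 = b)
    (c : Fin 2 → E3) (hc0 : c 0 = a) (hc1 : c 1 = b) :
    (Matrix.of fun i j : Fin 3 => ⟪e i, e j⟫).det =
      ⟪u, n⟫ ^ 2 * (Matrix.of fun i j : Fin 2 => ⟪c i, c j⟫).det := by
  have hn2 : ⟪n, n⟫ = 1 := by rw [real_inner_self_eq_norm_sq, hn]; norm_num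
  simp only [Matrix.det_fin_three, Matrix.det_fin_two, Matrix.of_apply, he0, he1, he2, hc0, hc1]
  simp only [PiLp.inner_apply, Fin.sum_univ_three, RCLike.inner_apply, conj_trivial] at *
  generalize u 0 = u0 at *
  generalize u 1 = u1 at *
  generalize u 2 = u2 at *
  generalize a 0 = a0 at *
  generalize a 1 = a1 at *
  generalize a 2 = a2 at *
  generalize b 0 = b0 at *
  generalize b 1 = b1 at *
  generalize b 2 = b2 at *
  generalize n 0 = n0 at *
  generalize n 1 = n1 at *
  generalize n 2 = n2 at *
  obtain ⟨x0, hx0⟩ : ∃ x, x = a1 * b2 - a2 * b1 := ⟨_, rfl⟩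
  obtain ⟨x1, hx1⟩ : ∃ x, x = a2 * b0 - a0 * b2 := ⟨_, rfl⟩
  obtain ⟨x2, hx2⟩ : ∃ x, x = a0 * b1 - a1 * b0 := ⟨_, rfl⟩
  have c0 : x1 * n2 - x2 * n1 = 0 := by
    rw [hx1, hx2]; linear_combination b0 * ha - a0 * hb
  have c1 : x2 * n0 - x0 * n2 = 0 := by
    rw [hx2, hx0]; linear_combination b1 * ha - a1 * hb
  have c2 : x0 * n1 - x1 * n0 = 0 := by
    rw [hx0, hx1]; linear_combination b2 * ha - a2 * hb
  obtain ⟨k, hk⟩ : ∃ k, k = x0 * n0 + x1 * n1 + x2 * n2 := ⟨_, rfl⟩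
  have e0 : x0 = k * n0 := by rw [hk]; linear_combination (-x0) * hn2 + n1 * c2 - n2 * c1
  have e1 : x1 = k * n1 := by rw [hk]; linear_combination (-x1) * hn2 + n2 * c0 - n0 * c2
  have e2 : x2 = k * n2 := by rw [hk]; linear_combination (-x2) * hn2 + n0 * c1 - n1 * c0
  have key : (u0 * x0 + u1 * x1 + u2 * x2) ^ 2 =
      (n0 * u0 + n1 * u1 + n2 * u2) ^ 2 * (x0 ^ 2 + x1 ^ 2 + x2 ^ 2) := by
    rw [e0, e1, e2]
    linear_combination (-k ^ 2 * (u0 * n0 + u1 * n1 + u2 * n2) ^ 2) * hn2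
  rw [hx0, hx1, hx2] at key
  linear_combination key

lemma gram_shift (e : Fin 3 → E3) (f : Fin 3 → E3) (h0 : f 0 = e 0) (h1 : f 1 = e 1 - e 0)
    (h2 : f 2 = e 2 - e 0) :
    (Matrix.of fun i j : Fin 3 => ⟪e i, e j⟫).det = (Matrix.of fun i j : Fin 3 => ⟪f i, f j⟫).det := by
  simp only [Matrix.det_fin_three, Matrix.of_apply, h0, h1, h2, inner_sub_left, inner_sub_right]
  ring

lemma face_eq (q : Fin 4 → E3) (i : Fin 4) :
    Face q i = convexHull ℝ (Set.range (q ∘ i.succAbove)) := by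
  unfold Face
  rw [Set.range_comp, Fin.range_succAbove]
  rfl

open MeasureTheory.Measure in
lemma gauss1 (q : Fin 4 → E3) (hq : AffineIndependent ℝ q) (n0 n1 : E3)
    (h0 : IsOutwardNormal q 0 n0) (h1 : IsOutwardNormal q 1 n1)
    (g : E3 → ℝ) (hg : ContDiff ℝ 1 g) :
    ∫ x in Tet q, fderiv ℝ g x (q 1 - q 0) =
      ⟪q 1 - q 0, n0⟫ * ∫ x in Face q 0, g x ∂μHE[2]
      + ⟪q 1 - q 0, n1⟫ * ∫ x in Face q 1, g x ∂μHE[2] := by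
  have hvol : (volume : Measure E3) = μHE[3] :=
    (EuclideanSpace.euclideanHausdorffMeasure_eq_volume 3).symm
  have hq0 : AffineIndependent ℝ (q ∘ (0 : Fin 4).succAbove) :=
    hq.comp_embedding (Fin.succAboveEmb 0)
  have hq1 : AffineIndependent ℝ (q ∘ (1 : Fin 4).succAbove) :=
    hq.comp_embedding (Fin.succAboveEmb 1)
  rw [face_eq, face_eq, simplex_int _ hq0, simplex_int _ hq1, Tet, hvol, simplex_int _ hq]
  have p0 : ⟪q 1 - q 0, n0⟫ > 0 := by
    have := h0.2.2 1 (by decide)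
    rw [← neg_sub, inner_neg_left] at this
    linarith
  have p1 : ⟪q 1 - q 0, n1⟫ < 0 := h1.2.2 0 (by decide)
  have J0 : (linP q).normDet = ⟪q 1 - q 0, n0⟫ * (linP (q ∘ (0 : Fin 4).succAbove)).normDet := by
    rw [← sq_eq_sq₀ (LinearMap.normDet_nonneg _) (mul_nonneg p0.le (LinearMap.normDet_nonneg _)),
      mul_pow, normDet_linP, normDet_linP]
    rw [gram_shift (fun i => q i.succ - q 0) ![q 1 - q 0, q 2 - q 1, q 3 - q 1] rfl
      (by simp) (by simp)]
    exact gram_three _ (q 2 - q 1) (q 3 - q 1) n0 (h0.2.1 2 1 (by decide) (by decide))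
      (h0.2.1 3 1 (by decide) (by decide)) h0.1 _ rfl rfl rfl _ rfl rfl
  have J1 : (linP q).normDet = -⟪q 1 - q 0, n1⟫ * (linP (q ∘ (1 : Fin 4).succAbove)).normDet := by
    rw [← sq_eq_sq₀ (LinearMap.normDet_nonneg _) (mul_nonneg (by linarith) (LinearMap.normDet_nonneg _)),
      mul_pow, normDet_linP, normDet_linP, neg_sq]
    exact gram_three _ (q 2 - q 0) (q 3 - q 0) n1 (h1.2.1 2 0 (by decide) (by decide))
      (h1.2.1 3 0 (by decide) (by decide)) h1.1 _ rfl rfl rfl _ rfl rfl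
  have hsum : ∀ (r : ℝ) (s : Fin 2 → ℝ),
      q 0 + ∑ i, (Fin.cons r s : Fin 3 → ℝ) i • (q i.succ - q 0)
        = (q 0 + s 0 • (q 2 - q 0) + s 1 • (q 3 - q 0)) + r • (q 1 - q 0) := by
    intro r s
    have : q 0 + ∑ i, (Fin.cons r s : Fin 3 → ℝ) i • (q i.succ - q 0) =
      q 0 + (r • (q 1 - q 0) + s 0 • (q 2 - q 0) + s 1 • (q 3 - q 0)) := by
      rw [Fin.sum_univ_three]; rfl
    rw [this]; abel
  have hcontP : Continuous fun t : Fin 3 → ℝ => q 0 + ∑ i, t i • (q i.succ - q 0) := by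
    fun_prop
  rw [ref_int (fun t => g (q 0 + ∑ i, t i • (q i.succ - q 0)))
    (fun t => fderiv ℝ g (q 0 + ∑ i, t i • (q i.succ - q 0)) (q 1 - q 0))]
  rotate_left
  · have := (hg.continuous_fderiv one_ne_zero).comp hcontP
    exact this.clm_apply continuous_const
  · intro r s
    simp only [hsum]
    have hd := (hg.differentiable one_ne_zero
      ((q 0 + s 0 • (q 2 - q 0) + s 1 • (q 3 - q 0)) + r • (q 1 - q 0))).hasFDerivAt
    have hl : HasDerivAt (fun r : ℝ => (q 0 + s 0 • (q 2 - q 0) + s 1 • (q 3 - q 0)) + r • (q 1 - q 0))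
        (q 1 - q 0) r := by
      simpa using ((hasDerivAt_id r).smul_const (q 1 - q 0)).const_add
        (q 0 + s 0 • (q 2 - q 0) + s 1 • (q 3 - q 0))
    exact hd.comp_hasDerivAt r hl
  have hgc := hg.continuous
  rw [integral_sub]
  rotate_left
  · refine ContinuousOn.integrableOn_compact (TT_compact 2) ?_
    simp only [hsum]
    fun_prop
  · refine ContinuousOn.integrableOn_compact (TT_compact 2) ?_
    simp only [hsum]
    fun_prop
  have i0 : ∀ s : Fin 2 → ℝ, q 0 + ∑ i, (Fin.cons (1 - ∑ i, s i) s : Fin 3 → ℝ) i • (q i.succ - q 0)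
      = (q ∘ (0 : Fin 4).succAbove) 0 + ∑ i : Fin 2, s i • ((q ∘ (0 : Fin 4).succAbove) i.succ - (q ∘ (0 : Fin 4).succAbove) 0) := by
    intro s
    rw [hsum, Fin.sum_univ_two, Fin.sum_univ_two]
    change _ = q 1 + (s 0 • (q 2 - q 1) + s 1 • (q 3 - q 1))
    module
  have i1 : ∀ s : Fin 2 → ℝ, q 0 + ∑ i, (Fin.cons 0 s : Fin 3 → ℝ) i • (q i.succ - q 0)
      = (q ∘ (1 : Fin 4).succAbove) 0 + ∑ i : Fin 2, s i • ((q ∘ (1 : Fin 4).succAbove) i.succ - (q ∘ (1 : Fin 4).succAbove) 0) := by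
    intro s
    rw [hsum, Fin.sum_univ_two]
    change _ = q 0 + (s 0 • (q 2 - q 0) + s 1 • (q 3 - q 0))
    module
  simp only [i0, i1]
  rw [mul_sub]
  nth_rewrite 1 [J0]
  rw [J1]
  ring

lemma tet_comp (v : Fin 4 → E3) (σ : Equiv.Perm (Fin 4)) : Tet (v ∘ σ) = Tet v := by
  unfold Tet; rw [σ.surjective.range_comp]

lemma face_comp (v : Fin 4 → E3) (σ : Equiv.Perm (Fin 4)) (i : Fin 4) :
    Face (v ∘ σ) i = Face v (σ i) := by
  unfold Face
  rw [Set.image_comp]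
  congr 2
  ext j
  simp only [Set.mem_image, Set.mem_ofPred_eq]
  constructor
  · rintro ⟨k, hk, rfl⟩
    exact fun h => hk (σ.injective h)
  · intro h
    exact ⟨σ.symm j, fun h' => h (by rw [← h']; simp), by simp⟩

lemma normal_comp (v : Fin 4 → E3) (σ : Equiv.Perm (Fin 4)) (i : Fin 4) (n : E3)
    (h : IsOutwardNormal v (σ i) n) : IsOutwardNormal (v ∘ σ) i n :=
  ⟨h.1, fun _ _ hj hk => h.2.1 _ _ (fun e => hj (σ.injective e)) (fun e => hk (σ.injective e)),
    fun _ hj => h.2.2 _ (fun e => hj (σ.injective e))⟩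

open MeasureTheory.Measure in
lemma gauss2 (v : Fin 4 → E3) (hv : AffineIndependent ℝ v) (n : Fin 4 → E3)
    (hn : ∀ i, IsOutwardNormal v i (n i))
    (g : E3 → ℝ) (hg : ContDiff ℝ 1 g) (k : Fin 4) (hk : k ≠ 0) :
    ∫ x in Tet v, fderiv ℝ g x (v k - v 0) =
      ∑ i, ⟪v k - v 0, n i⟫ * ∫ x in Face v i, g x ∂μHE[2] := by
  have s0 : (Equiv.swap 1 k : Equiv.Perm (Fin 4)) 0 = 0 :=
    Equiv.swap_apply_of_ne_of_ne (by decide) hk.symm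
  have s1 : (Equiv.swap 1 k : Equiv.Perm (Fin 4)) 1 = k := Equiv.swap_apply_left _ _
  have := gauss1 (v ∘ (Equiv.swap 1 k : Equiv.Perm (Fin 4)))
    (hv.comp_embedding (Equiv.swap 1 k : Equiv.Perm (Fin 4)).toEmbedding) (n 0) (n k)
    (normal_comp _ _ _ _ (by rw [s0]; exact hn 0)) (normal_comp _ _ _ _ (by rw [s1]; exact hn k)) g hg
  rw [tet_comp, face_comp, face_comp] at this
  simp only [Function.comp, s0, s1] at this
  rw [this, Finset.sum_eq_add 0 k hk.symm]
  · intro c _ hc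
    rw [(hn c).2.1 k 0 hc.2.symm hc.1.symm, zero_mul]
  · simp
  · simp

open MeasureTheory.Measure in
lemma gauss (v : Fin 4 → E3) (hv : AffineIndependent ℝ v) (n : Fin 4 → E3)
    (hn : ∀ i, IsOutwardNormal v i (n i))
    (g : E3 → ℝ) (hg : ContDiff ℝ 1 g) (w : E3) :
    ∫ x in Tet v, fderiv ℝ g x w =
      ∑ i, ⟪w, n i⟫ * ∫ x in Face v i, g x ∂μHE[2] := by
  have hcomp : IsCompact (Tet v) := (Set.finite_range v).isCompact_convexHull ℝ
  have hint : ∀ w : E3, IntegrableOn (fun x => fderiv ℝ g x w) (Tet v) := fun w =>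
    ((hg.continuous_fderiv one_ne_zero).clm_apply continuous_const).continuousOn.integrableOn_compact hcomp
  have hspan : Submodule.span ℝ (Set.range fun i : Fin 3 => v i.succ - v 0) = ⊤ := by
    have h := (affineIndependent_iff_linearIndependent_vsub ℝ v 0).1 hv
    have h2 : LinearIndependent ℝ (fun i : Fin 3 => v i.succ - v 0) :=
      h.comp (fun i : Fin 3 => (⟨i.succ, Fin.succ_ne_zero i⟩ : {x : Fin 4 // x ≠ 0}))
        (fun i j hij => by simpa using hij)
    exact h2.span_eq_top_of_card_eq_finrank (by simp)
  have hw : w ∈ Submodule.span ℝ (Set.range fun i : Fin 3 => v i.succ - v 0) := by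
    rw [hspan]; trivial
  induction hw using Submodule.span_induction with
  | mem x hx =>
    obtain ⟨i, rfl⟩ := hx
    exact gauss2 v hv n hn g hg i.succ (Fin.succ_ne_zero i)
  | zero => simp
  | add x y _ _ hx hy =>
    simp only [map_add, inner_add_left, add_mul, Finset.sum_add_distrib]
    rw [integral_add (hint x) (hint y), hx, hy]
  | smul a x _ hx =>
    simp only [map_smul, inner_smul_left, smul_eq_mul, integral_const_mul, hx, Finset.mul_sum,
      conj_trivial, mul_assoc]

lemma exists_normal (v : Fin 4 → E3) (hv : AffineIndependent ℝ v) (i : Fin 4) :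
    ∃ n, IsOutwardNormal v i n := by
  have htop : affineSpan ℝ (Set.range v) = ⊤ :=
    hv.affineSpan_eq_top_iff_card_eq_finrank_add_one.2 (by simp)
  let b : AffineBasis (Fin 4) ℝ E3 := ⟨v, hv, htop⟩
  let l : E3 →L[ℝ] ℝ := LinearMap.toContinuousLinearMap (b.coord i).linear
  let w : E3 := (InnerProductSpace.toDual ℝ E3).symm l
  have hw : ∀ j k, ⟪v j - v k, w⟫ = b.coord i (v j) - b.coord i (v k) := by
    intro j k
    rw [real_inner_comm, InnerProductSpace.toDual_symm_apply]
    exact (b.coord i).linearMap_vsub (v j) (v k)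
  have hi : b.coord i (v i) = 1 := b.coord_apply_eq i
  have hj : ∀ j, j ≠ i → b.coord i (v j) = 0 := fun j h => b.coord_apply_ne h.symm
  obtain ⟨j0, hj0⟩ := exists_ne i
  have hw0 : w ≠ 0 := by
    intro h
    have := hw i j0
    rw [hi, hj _ hj0, h] at this
    simp at this
  have hpos : 0 < ‖w‖ := norm_pos_iff.2 hw0
  refine ⟨(-‖w‖⁻¹) • w, ?_, ?_, ?_⟩
  · rw [norm_smul, norm_neg, norm_inv, norm_norm, inv_mul_cancel₀ hpos.ne']
  · intro j k h1 h2
    rw [inner_smul_right, hw, hj _ h1, hj _ h2]; simp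
  · intro j h1
    rw [inner_smul_right, hw, hi, hj _ h1]
    simpa using hpos

open MeasureTheory.Measure in
lemma hausdorff_scale : ∃ c : ℝ, ∀ (S : Set E3) (f : E3 → ℝ),
    ∫ x in S, f x ∂μHE[2] = c * ∫ x in S, f x ∂μH[2] := by
  refine ⟨addHaarScalarFactor (volume : Measure (EuclideanSpace ℝ (Fin 2))) μH[(2 : ℕ)], fun S f => ?_⟩
  rw [euclideanHausdorffMeasure_def, Measure.restrict_smul, integral_smul_nnreal_measure]
  norm_num [NNReal.smul_def]

open MeasureTheory.Measure in
lemma face_finite (q : Fin 4 → E3) (i : Fin 4) : (μHE[2] : Measure E3) (Face q i) < ⊤ := by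
  rw [face_eq, hull_eq]
  have : (fun s => (q ∘ i.succAbove) 0 + linP (q ∘ i.succAbove) (WithLp.toLp 2 s)) '' TT 2 =
      (IsometryEquiv.addLeft ((q ∘ i.succAbove) 0)) ''
        (linP (q ∘ i.succAbove) '' (WithLp.toLp 2 '' TT 2)) := by
    rw [Set.image_image, Set.image_image]; rfl
  rw [this, (IsometryEquiv.addLeft ((q ∘ i.succAbove) 0)).isometry.euclideanHausdorffMeasure_image]
  have h1 := (linP (q ∘ i.succAbove)).euclideanHausdorffMeasure_image_eq_normDet_mul_volume
    (WithLp.toLp 2 '' TT 2)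
  rw [finrank_euclideanSpace, Fintype.card_fin] at h1
  rw [h1]
  refine ENNReal.mul_lt_top ENNReal.ofReal_lt_top ?_
  exact ((TT_compact 2).image (PiLp.continuous_toLp 2 _)).measure_lt_top

lemma poly_contDiff (P : MvPolynomial (Fin 3) ℝ) :
    ContDiff ℝ 1 (fun x : E3 => MvPolynomial.eval (fun i => x i) P) := by
  induction P using MvPolynomial.induction_on with
  | C a => simpa using contDiff_const
  | add p q hp hq => simpa using hp.add hq
  | mul_X p i hp =>
    simp only [map_mul, MvPolynomial.eval_X]
    exact hp.mul (by fun_prop)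

/-- If `τ ∈ P₂(K;𝕊)` is divergence-free and the boundary integral
`∫_{∂K} τn · v ds` (a sum over the four faces, with their outward unit normals)
vanishes for every affine vector field `v ∈ P₁(K;ℝ³)`, then `∫_K τ dx = 0`
entrywise. -/
theorem stmt_13 (v : Fin 4 → E3) (hv : AffineIndependent ℝ v)
    (τ : E3 → Matrix (Fin 3) (Fin 3) ℝ)
    (hpoly : ∀ i j : Fin 3, IsPolyLE 2 (fun x => τ x i j))
    (hsymm : ∀ x ∈ Tet v, (τ x).IsSymm)
    (hdiv : ∀ x ∈ Tet v, ∀ r : Fin 3, divRow τ r x = 0)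
    (hbdry : ∀ n : Fin 4 → E3, (∀ i, IsOutwardNormal v i (n i)) →
      ∀ w : Fin 3 → (E3 →ᵃ[ℝ] ℝ),
        (∑ i : Fin 4, ∫ x in Face v i,
          ((τ x).mulVec (fun r => n i r)) ⬝ᵥ (fun r => w r x) ∂μH[2]) = 0) :
    ∀ i j : Fin 3, (∫ x in Tet v, τ x i j) = 0 := by
  intro i j
  choose n hn using exists_normal v hv
  obtain ⟨c, hc⟩ := hausdorff_scale
  have hτ : ∀ i m, ContDiff ℝ 1 (fun x => τ x i m) := by
    intro i m
    obtain ⟨P, -, hP⟩ := hpoly i m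
    have : (fun x => τ x i m) = fun x : E3 => MvPolynomial.eval (fun i => x i) P := funext hP
    rw [this]
    exact poly_contDiff P
  have hcomp : IsCompact (Tet v) := (Set.finite_range v).isCompact_convexHull ℝ
  have hfcomp : ∀ k, IsCompact (Face v k) := fun k =>
    ((Set.toFinite _).image v).isCompact_convexHull ℝ
  have hx : ContDiff ℝ 1 (fun x : E3 => x j) := by fun_prop
  let g : Fin 3 → E3 → ℝ := fun m x => τ x i m * x j
  have hg : ∀ m, ContDiff ℝ 1 (g m) := fun m => (hτ i m).mul hx
  let w : Fin 3 → (E3 →ᵃ[ℝ] ℝ) := fun r =>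
    if r = i then (EuclideanSpace.proj j : E3 →L[ℝ] ℝ).toLinearMap.toAffineMap else 0
  have hw : ∀ x r, w r x = if r = i then x j else 0 := by
    intro x r
    by_cases h : r = i
    · simp [w, h]
    · simp [w, h]
  have hb := hbdry n hn w
  have hb2 : ∑ k : Fin 4, ∫ x in Face v k, ∑ m, n k m * g m x ∂Measure.euclideanHausdorffMeasure 2 = 0 := by
    have e : ∀ k x, ((τ x).mulVec (fun r => n k r)) ⬝ᵥ (fun r => w r x) = ∑ m, n k m * g m x := by
      intro k x
      simp only [hw, dotProduct, mulVec, mul_ite, mul_zero, Finset.sum_ite_eq', Finset.mem_univ,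
        if_true, Finset.sum_mul, g]
      exact Finset.sum_congr rfl fun m _ => by ring
    simp only [e] at hb
    simp only [hc, ← Finset.mul_sum, hb, mul_zero]
  have hfi : ∀ k m, IntegrableOn (g m) (Face v k) (Measure.euclideanHausdorffMeasure 2) := by
    intro k m
    obtain ⟨C, hC⟩ := (hfcomp k).exists_bound_of_continuousOn (hg m).continuous.continuousOn
    exact Measure.integrableOn_of_bounded (face_finite v k).ne
      (hg m).continuous.aestronglyMeasurable
      ((ae_restrict_iff' (hfcomp k).isClosed.measurableSet).2 (Filter.Eventually.of_forall hC))
  have hb3 : ∑ m, ∫ x in Tet v, fderiv ℝ (g m) x (EuclideanSpace.single m 1) = 0 := by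
    rw [← hb2]
    simp only [gauss v hv n hn _ (hg _)]
    rw [Finset.sum_comm]
    refine Finset.sum_congr rfl fun k _ => ?_
    rw [integral_finsetSum _ fun m _ => (hfi k m).const_mul _]
    refine Finset.sum_congr rfl fun m _ => ?_
    rw [integral_const_mul]
    congr 1
    simp [EuclideanSpace.inner_single_left]
  have hti : ∀ m, IntegrableOn (fun x => fderiv ℝ (g m) x (EuclideanSpace.single m 1)) (Tet v) :=
    fun m => (((hg m).continuous_fderiv one_ne_zero).clm_apply
      continuous_const).continuousOn.integrableOn_compact hcomp
  rw [← integral_finsetSum _ fun m _ => hti m] at hb3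
  rw [← hb3]
  refine setIntegral_congr_fun hcomp.isClosed.measurableSet fun x hxT => ?_
  have hd := hdiv x hxT i
  unfold divRow at hd
  have hf : ∀ m, fderiv ℝ (g m) x (EuclideanSpace.single m 1) =
      (if m = j then τ x i m else 0)
        + x j * fderiv ℝ (fun y => τ y i m) x (EuclideanSpace.single m 1) := by
    intro m
    have h1 := ((hτ i m).differentiable one_ne_zero x).hasFDerivAt
    have h2 : HasFDerivAt (fun y : E3 => y j) (EuclideanSpace.proj j : E3 →L[ℝ] ℝ) x :=
      (EuclideanSpace.proj j : E3 →L[ℝ] ℝ).hasFDerivAt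
    have h3 : HasFDerivAt (g m) _ x := h1.mul h2
    rw [h3.fderiv]
    by_cases h : m = j
    · simp [h]
    · simp [h, Ne.symm h]
  simp only [hf, Finset.sum_add_distrib, ← Finset.mul_sum, hd]
  simp
end
end

section
/- Let K be a nondegenerate tetrahedron in ℝ³. Then the real vector space Σ̃_K = { τ ∈ Σ_K : div τ ∈ 𝕋(K) } has dimension exactly 36, where div τ is the row-wise divergence. -/
open MeasureTheory RealInnerProductSpace Matrix

noncomputable section

/-- Membership in the shape-function space
`Σ_K = {σ ∈ P₂(K;𝕊) : Q_{s_e} σ Q_{s_e}|_e ∈ P₁(e;𝕊) for every edge e of K}`. -/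
def MemSigmaK (v : Fin 4 → E3) (σ : E3 → Matrix (Fin 3) (Fin 3) ℝ) : Prop :=
  (∀ i j : Fin 3, IsPolyLE 2 (fun x => σ x i j)) ∧
  (∀ x ∈ Tet v, (σ x).IsSymm) ∧
  (∀ k l : Fin 4, k ≠ l → ∀ s : E3, ‖s‖ = 1 → (∃ c : ℝ, v l - v k = c • s) →
    ∀ i j : Fin 3, AffineOn (Edge v k l) (fun x => (Qmat s * σ x * Qmat s) i j))

/-- `u` coincides on `s` with a rigid motion `x ↦ a + b × x`. -/
def IsRigidOn (s : Set E3) (u : E3 → (Fin 3 → ℝ)) : Prop :=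
  ∃ a b : Fin 3 → ℝ, ∀ x ∈ s, u x = a + crossProduct b (fun m => x m)

/-- Membership in the reduced shape-function space
`Σ̃_K = {τ ∈ Σ_K : div τ ∈ 𝕋(K)}`. -/
def MemSigmaTildeK (v : Fin 4 → E3) (τ : E3 → Matrix (Fin 3) (Fin 3) ℝ) : Prop :=
  MemSigmaK v τ ∧ IsRigidOn (Tet v) (fun x r => divRow τ r x)


abbrev M3 := Matrix (Fin 3) (Fin 3) ℝ

/-- Quadratic function with given coefficients. -/
def qf (c : ℝ) (d : Fin 3 → ℝ) (h : Fin 3 → Fin 3 → ℝ) (x : E3) : ℝ :=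
  c + ∑ n, d n * x n + ∑ n, ∑ l, h n l * x n * x l

lemma qf_isPoly (c : ℝ) (d : Fin 3 → ℝ) (h : Fin 3 → Fin 3 → ℝ) : IsPolyLE 2 (qf c d h) := by
  refine ⟨MvPolynomial.C c + ∑ n, MvPolynomial.C (d n) * MvPolynomial.X n +
    ∑ n, ∑ l, MvPolynomial.C (h n l) * MvPolynomial.X n * MvPolynomial.X l, ?_, ?_⟩
  · refine (MvPolynomial.totalDegree_add _ _).trans (max_le
      ((MvPolynomial.totalDegree_add _ _).trans (max_le ?_ ?_)) ?_)
    · simp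
    · refine (MvPolynomial.totalDegree_finsetSum _ _).trans (Finset.sup_le fun n _ => ?_)
      refine (MvPolynomial.totalDegree_mul _ _).trans ?_
      simp
    · refine (MvPolynomial.totalDegree_finsetSum _ _).trans (Finset.sup_le fun n _ => ?_)
      refine (MvPolynomial.totalDegree_finsetSum _ _).trans (Finset.sup_le fun l _ => ?_)
      refine (MvPolynomial.totalDegree_mul _ _).trans ?_
      have := MvPolynomial.totalDegree_mul (MvPolynomial.C (h n l)) (MvPolynomial.X n : MvPolynomial (Fin 3) ℝ)
      simp at this ⊢
      omega
  · intro x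
    simp [qf]

lemma isPoly_qf (p : E3 → ℝ) (hp : IsPolyLE 2 p) : ∃ c d h, p = qf c d h := by
  obtain ⟨P, hP, hx⟩ := hp
  have hp : p = fun x : E3 => MvPolynomial.eval (fun i => x i) P := funext hx
  rw [hp]
  clear hp hx
  have key : ∀ s : Finset (Fin 3 →₀ ℕ), (∀ m ∈ s, (m.sum fun _ e => e) ≤ 2) →
      ∃ c d h, (fun x : E3 => ∑ m ∈ s, P.coeff m * ∏ i, (x i) ^ (m i)) = qf c d h := by
    intro s
    induction s using Finset.induction_on with
    | empty => intro _; exact ⟨0, 0, 0, by funext x; simp [qf]⟩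
    | insert m s hm ih =>
      intro hs
      obtain ⟨c, d, h, e⟩ := ih (fun m' h' => hs m' (Finset.mem_insert_of_mem h'))
      have h2 := hs m (Finset.mem_insert_self _ _)
      rw [Finsupp.sum_fintype _ _ (fun _ => rfl), Fin.sum_univ_three] at h2
      have : ∃ c d h, (fun x : E3 => P.coeff m * ∏ i, (x i) ^ (m i)) = qf c d h := by
        generalize P.coeff m = a
        simp only [Fin.prod_univ_three]
        generalize m 0 = m0 at *
        generalize m 1 = m1 at *
        generalize m 2 = m2 at *
        by_cases H0 : m0 + m1 + m2 = 0
        · obtain ⟨rfl, rfl, rfl⟩ : m0 = 0 ∧ m1 = 0 ∧ m2 = 0 := by omega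
          exact ⟨a, 0, 0, by funext x; simp [qf]⟩
        by_cases H1 : m0 + m1 + m2 = 1
        · refine ⟨0, ![m0 * a, m1 * a, m2 * a], 0, ?_⟩
          funext x
          have h0 : m0 ≤ 1 := by omega
          have h1 : m1 ≤ 1 := by omega
          have h2' : m2 ≤ 1 := by omega
          interval_cases m0 <;> interval_cases m1 <;> interval_cases m2 <;> first | omega | simp [qf, Fin.sum_univ_three]
        · have h3 : m0 + m1 + m2 = 2 := by omega
          have h0 : m0 ≤ 2 := by omega
          have h1 : m1 ≤ 2 := by omega
          have h2' : m2 ≤ 2 := by omega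
          refine ⟨0, 0, ![![if m0 = 2 then a else 0, if m0 = 1 ∧ m1 = 1 then a else 0, if m0 = 1 ∧ m2 = 1 then a else 0],
            ![0, if m1 = 2 then a else 0, if m1 = 1 ∧ m2 = 1 then a else 0], ![0, 0, if m2 = 2 then a else 0]], ?_⟩
          funext x
          interval_cases m0 <;> interval_cases m1 <;> interval_cases m2 <;> first | omega | (simp [qf, Fin.sum_univ_three]; try ring)
      obtain ⟨c', d', h', e'⟩ := this
      refine ⟨c' + c, d' + d, h' + h, ?_⟩
      funext x
      rw [Finset.sum_insert hm]
      have e1 := congrFun e x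
      have e2 := congrFun e' x
      simp only at e1 e2
      rw [e1, e2]
      simp only [qf, Pi.add_apply, add_mul, Finset.sum_add_distrib]
      ring
  obtain ⟨c, d, h, e⟩ := key P.support (fun m hm => (MvPolynomial.le_totalDegree hm).trans hP)
  refine ⟨c, d, h, ?_⟩
  rw [← e]
  funext x
  rw [MvPolynomial.eval_eq']

lemma qf_hasFDerivAt (c : ℝ) (d : Fin 3 → ℝ) (h : Fin 3 → Fin 3 → ℝ) (x : E3) (m : Fin 3) :
    fderiv ℝ (qf c d h) x (EuclideanSpace.single m 1) = d m + ∑ l, (h m l + h l m) * x l := by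
  have hc : ∀ n : Fin 3, HasFDerivAt (fun y : E3 => y n) (EuclideanSpace.proj n : E3 →L[ℝ] ℝ) x := fun n =>
    (EuclideanSpace.proj n : E3 →L[ℝ] ℝ).hasFDerivAt
  have H : HasFDerivAt (qf c d h) ((0 : E3 →L[ℝ] ℝ) + ∑ n, d n • (EuclideanSpace.proj n : E3 →L[ℝ] ℝ) +
    ∑ n, ∑ l, ((h n l * x n) • (EuclideanSpace.proj l : E3 →L[ℝ] ℝ) + x l • (h n l • (EuclideanSpace.proj n : E3 →L[ℝ] ℝ)))) x := by
    unfold qf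
    refine ((hasFDerivAt_const c x).add ?_).add ?_
    · exact HasFDerivAt.fun_sum fun n _ => (hc n).const_mul _
    · exact HasFDerivAt.fun_sum fun n _ => HasFDerivAt.fun_sum fun l _ => ((hc n).const_mul _).mul (hc l)
  rw [H.fderiv]
  fin_cases m <;> simp [Fin.sum_univ_three] <;> ring

lemma qf_analytic (c : ℝ) (d : Fin 3 → ℝ) (h : Fin 3 → Fin 3 → ℝ) :
    AnalyticOnNhd ℝ (qf c d h) Set.univ := by
  intro x _
  have hc : ∀ n : Fin 3, AnalyticAt ℝ (fun y : E3 => y n) x := fun n =>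
    (EuclideanSpace.proj n : E3 →L[ℝ] ℝ).analyticAt x
  unfold qf
  refine (analyticAt_const.add ?_).add ?_
  · exact Finset.analyticAt_fun_sum _ fun n _ => analyticAt_const.mul (hc n)
  · exact Finset.analyticAt_fun_sum _ fun n _ => Finset.analyticAt_fun_sum _ fun l _ => (analyticAt_const.mul (hc n)).mul (hc l)

lemma qf_zero_of_tet (v : Fin 4 → E3) (hv : AffineIndependent ℝ v) (c : ℝ) (d : Fin 3 → ℝ)
    (h : Fin 3 → Fin 3 → ℝ) (h0 : ∀ x ∈ Tet v, qf c d h x = 0) (x : E3) : qf c d h x = 0 := by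
  have hspan : affineSpan ℝ (Set.range v) = ⊤ := by
    apply hv.affineSpan_eq_top_iff_card_eq_finrank_add_one.2
    simp
  have hint : (interior (Tet v)).Nonempty := by
    unfold Tet
    rw [interior_convexHull_nonempty_iff_affineSpan_eq_top]
    exact hspan
  obtain ⟨z, hz⟩ := hint
  have := (qf_analytic c d h).eqOn_zero_of_preconnected_of_eventuallyEq_zero isPreconnected_univ (Set.mem_univ z) ?_
  · exact this (Set.mem_univ x)
  · filter_upwards [isOpen_interior.mem_nhds hz] with y hy
    exact h0 y (interior_subset hy)

lemma qf_coeff (c : ℝ) (d : Fin 3 → ℝ) (h : Fin 3 → Fin 3 → ℝ) (h0 : ∀ x, qf c d h x = 0) :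
    c = 0 ∧ d = 0 ∧ ∀ y : Fin 3 → ℝ, ∑ n, ∑ l, h n l * y n * y l = 0 := by
  have hc : c = 0 := by simpa [qf] using h0 0
  have hh : ∀ y : Fin 3 → ℝ, ∑ n, ∑ l, h n l * y n * y l = 0 := by
    intro y
    have h1 := h0 (WithLp.toLp 2 y)
    have h2 := h0 (WithLp.toLp 2 (-y))
    simp [qf] at h1 h2
    linarith
  refine ⟨hc, ?_, hh⟩
  funext i
  have h1 := h0 (EuclideanSpace.single i 1)
  have h2 := hh (fun n => (EuclideanSpace.single i (1:ℝ) : E3) n)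
  unfold qf at h1
  rw [h2, hc] at h1
  simpa using h1

/-- Homogeneous quadratic part of a matrix field. -/
def HH (h : Fin 3 → Fin 3 → Fin 3 → Fin 3 → ℝ) (y : Fin 3 → ℝ) : M3 :=
  Matrix.of fun i j => ∑ n, ∑ l, h i j n l * y n * y l

/-- Quadratic matrix field. -/
def QF (c : M3) (d : Fin 3 → Fin 3 → Fin 3 → ℝ) (h : Fin 3 → Fin 3 → Fin 3 → Fin 3 → ℝ)
    (x : E3) : M3 := Matrix.of fun i j => qf (c i j) (d i j) (h i j) x

lemma qf_line (c : ℝ) (d : Fin 3 → ℝ) (h : Fin 3 → Fin 3 → ℝ) (a b : E3) (r : ℝ) :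
    qf c d h (AffineMap.lineMap a b r) = qf c d h a
      + r * (qf c d h b - qf c d h a - ∑ n, ∑ l, h n l * (b - a) n * (b - a) l)
      + r ^ 2 * ∑ n, ∑ l, h n l * (b - a) n * (b - a) l := by
  simp only [qf, AffineMap.lineMap_apply, Fin.sum_univ_three, vsub_eq_sub, vadd_eq_add,
    PiLp.add_apply, PiLp.smul_apply, PiLp.sub_apply, smul_eq_mul]
  ring

lemma QF_line (c d h) (a b : E3) (r : ℝ) :
    QF c d h (AffineMap.lineMap a b r) = QF c d h a
      + r • (QF c d h b - QF c d h a - HH h (fun i => (b - a) i))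
      + r ^ 2 • HH h (fun i => (b - a) i) := by
  ext i j
  simp only [QF, HH, Matrix.of_apply, Matrix.add_apply, Matrix.smul_apply, Matrix.sub_apply,
    smul_eq_mul]
  exact qf_line _ _ _ _ _ _

lemma exists_affine (a b : E3) (hab : a ≠ b) (α β : ℝ) :
    ∃ q : E3 →ᵃ[ℝ] ℝ, q a = α ∧ q b = β := by
  let f : E3 →ₗ[ℝ] ℝ := ((β - α) / inner ℝ (b - a) (b - a)) • (innerSL ℝ (b - a)).toLinearMap
  refine ⟨f.toAffineMap + AffineMap.const ℝ E3 (α - f a), by simp, ?_⟩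
  have h0 : inner ℝ (b - a) (b - a) ≠ (0:ℝ) := by
    rw [inner_self_ne_zero]; exact sub_ne_zero.2 hab.symm
  have : f (b - a) = β - α := by
    simp only [f, LinearMap.smul_apply, ContinuousLinearMap.coe_coe, innerSL_apply_apply, smul_eq_mul]
    field_simp
  rw [map_sub] at this
  simp
  linarith

lemma Qmat_mulVec (s : E3) (hs : ‖s‖ = 1) : Qmat s *ᵥ (fun i => s i) = 0 := by
  have h1 : ∑ i, s i * s i = 1 := by
    have := EuclideanSpace.real_norm_sq_eq s
    rw [hs] at this
    simp only [sq] at this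
    linarith
  unfold Qmat
  rw [Matrix.sub_mulVec, Matrix.one_mulVec, Matrix.vecMulVec_mulVec]
  have : (fun i => s i) ⬝ᵥ (fun i => s i) = (1:ℝ) := h1
  rw [this]; simp

lemma Qmat_transpose (s : E3) : (Qmat s)ᵀ = Qmat s := by
  unfold Qmat
  simp [Matrix.transpose_vecMulVec]

lemma Q_kill (s : E3) (hs : ‖s‖ = 1) (u : Fin 3 → ℝ) (t : Fin 3 → ℝ) (c : ℝ)
    (ht : t = c • (fun i => s i)) :
    Qmat s * (vecMulVec t u + vecMulVec u t) * Qmat s = 0 := by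
  have h1 : Qmat s *ᵥ t = 0 := by
    rw [ht, Matrix.mulVec_smul, Qmat_mulVec s hs, smul_zero]
  have h2 : t ᵥ* Qmat s = 0 := by
    rw [← Matrix.mulVec_transpose, Qmat_transpose, h1]
  rw [Matrix.mul_add, Matrix.add_mul, Matrix.mul_vecMulVec, h1, Matrix.mul_assoc, Matrix.vecMulVec_mul, Matrix.vecMulVec_mul, h2]
  simp

lemma Q_form (s : E3) (M : M3) (hM : Mᵀ = M) (h0 : Qmat s * M * Qmat s = 0) :
    ∃ u, M = vecMulVec (fun i => s i) u + vecMulVec u (fun i => s i) := by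
  set t : Fin 3 → ℝ := fun i => s i with ht
  have hv : t ᵥ* M = M *ᵥ t := by
    rw [← Matrix.mulVec_transpose, hM]
  refine ⟨M *ᵥ t - (1/2 * (t ⬝ᵥ M *ᵥ t)) • t, ?_⟩
  have : Qmat s * M * Qmat s = M - vecMulVec t (M *ᵥ t) - vecMulVec (M *ᵥ t) t
      + (t ⬝ᵥ M *ᵥ t) • vecMulVec t t := by
    unfold Qmat
    rw [← ht]
    simp only [Matrix.sub_mul, Matrix.mul_sub, Matrix.one_mul, Matrix.mul_one, Matrix.mul_vecMulVec,
      Matrix.vecMulVec_mul, hv, Matrix.sub_mulVec, Matrix.vecMulVec_mulVec]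
    ext i j
    simp [vecMulVec_apply, dotProduct_comm]
    ring
  rw [this] at h0
  ext i j
  have := congrFun (congrFun h0 i) j
  simp [vecMulVec_apply] at this ⊢
  linarith

lemma edge_fwd (c d h) (a b : E3) (hab : a ≠ b) (s : E3)
    (ht : ∃ r : ℝ, b - a = r • s)
    (hsym : (HH h (fun i => (b - a) i))ᵀ = HH h (fun i => (b - a) i))
    (H : ∀ i j : Fin 3, AffineOn (segment ℝ a b) (fun x => (Qmat s * QF c d h x * Qmat s) i j)) :
    ∃ u, HH h (fun i => (b - a) i) = vecMulVec (fun i => (b - a) i) u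
      + vecMulVec u (fun i => (b - a) i) := by
  obtain ⟨r, hr⟩ := ht
  have hr0 : r ≠ 0 := by
    rintro rfl
    rw [zero_smul, sub_eq_zero] at hr
    exact hab hr.symm
  have h0 : Qmat s * HH h (fun i => (b - a) i) * Qmat s = 0 := by
    ext i j
    obtain ⟨q, hq⟩ := H i j
    have hmem : ∀ r ∈ Set.Icc (0:ℝ) 1, AffineMap.lineMap a b r ∈ segment ℝ a b := by
      intro r hr
      rw [segment_eq_image_lineMap]
      exact ⟨r, hr, rfl⟩
    have e0 := hq _ (hmem 0 (by norm_num))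
    have e1 := hq _ (hmem 1 (by norm_num))
    have e2 := hq _ (hmem (1/2) (by norm_num))
    simp only [QF_line, AffineMap.apply_lineMap, Matrix.mul_add, Matrix.add_mul, Matrix.mul_smul,
      Matrix.smul_mul, Matrix.add_apply, Matrix.smul_apply, smul_eq_mul] at e0 e1 e2
    simp only [AffineMap.lineMap_apply, vsub_eq_sub, vadd_eq_add, smul_eq_mul] at e0 e1 e2
    rw [Matrix.zero_apply]
    linarith
  obtain ⟨u, hu⟩ := Q_form s _ hsym h0
  refine ⟨r⁻¹ • u, ?_⟩
  rw [hu]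
  have : (fun i => (b - a) i) = r • (fun i => s i) := by
    funext i; rw [hr]; simp
  rw [this]
  ext i j
  simp [vecMulVec_apply]
  field_simp

lemma edge_bwd (c d h) (a b : E3) (hab : a ≠ b) (s : E3) (hs : ‖s‖ = 1)
    (ht : ∃ r : ℝ, b - a = r • s) 
    (H : ∃ u, HH h (fun i => (b - a) i) = vecMulVec (fun i => (b - a) i) u
      + vecMulVec u (fun i => (b - a) i)) :
    ∀ i j : Fin 3, AffineOn (segment ℝ a b) (fun x => (Qmat s * QF c d h x * Qmat s) i j) := by
  intro i j
  obtain ⟨r, hr⟩ := ht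
  obtain ⟨u, hu⟩ := H
  have h0 : Qmat s * HH h (fun i => (b - a) i) * Qmat s = 0 := by
    rw [hu]
    refine Q_kill s hs u _ r ?_
    funext i; rw [hr]; simp
  obtain ⟨q, hqa, hqb⟩ := exists_affine a b hab ((Qmat s * QF c d h a * Qmat s) i j)
    ((Qmat s * QF c d h b * Qmat s) i j)
  refine ⟨q, fun x hx => ?_⟩
  rw [segment_eq_image_lineMap] at hx
  obtain ⟨θ, _, rfl⟩ := hx
  simp only [QF_line, AffineMap.apply_lineMap, hqa, hqb, Matrix.mul_add, Matrix.add_mul, Matrix.mul_smul,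
      Matrix.smul_mul, Matrix.mul_sub, Matrix.sub_mul, h0]
  simp [AffineMap.lineMap_apply]
  ring

/-- Jacobian of the divergence of a quadratic matrix field. -/
def JJ (h : Fin 3 → Fin 3 → Fin 3 → Fin 3 → ℝ) : M3 :=
  Matrix.of fun r l => ∑ m, (h r m m l + h r m l m)

lemma divRow_QF (c d h) (r : Fin 3) (x : E3) :
    divRow (QF c d h) r x = ∑ m, d r m m + ∑ l, JJ h r l * x l := by
  have : ∀ m, (fun y => QF c d h y r m) = qf (c r m) (d r m) (h r m) := fun m => rfl
  simp only [divRow, this, qf_hasFDerivAt, JJ, Matrix.of_apply, Fin.sum_univ_three]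
  ring

lemma rigid_iff (v : Fin 4 → E3) (hv : AffineIndependent ℝ v) (c d h) :
    IsRigidOn (Tet v) (fun x r => divRow (QF c d h) r x) ↔ JJ h + (JJ h)ᵀ = 0 := by
  constructor
  · rintro ⟨a, b, H⟩
    let K : M3 := !![0, -b 2, b 1; b 2, 0, -b 0; -b 1, b 0, 0]
    have hK : ∀ r l, JJ h r l = K r l := by
      intro r l
      have h0 : ∀ x ∈ Tet v, qf (∑ m, d r m m - a r) (JJ h r - K r) 0 x = 0 := by
        intro x hx
        have := congrFun (H x hx) r
        simp only [divRow_QF] at this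
        simp only [qf, Pi.sub_apply, Pi.zero_apply, zero_mul, Finset.sum_const_zero, sub_mul, Finset.sum_sub_distrib]
        have h2 : ∑ n, K r n * x n = (crossProduct b (fun m => x m)) r := by
          rw [cross_apply]
          fin_cases r <;> simp [K, Fin.sum_univ_three] <;> ring
        rw [h2]
        simp only [Pi.add_apply] at this
        linarith
      have := (qf_coeff _ _ _ (qf_zero_of_tet v hv _ _ _ h0)).2.1
      have := congrFun this l
      simp only [Pi.sub_apply, Pi.zero_apply] at this
      linarith
    ext r l
    simp only [Matrix.add_apply, Matrix.transpose_apply, hK]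
    fin_cases r <;> fin_cases l <;> simp [K]
  · intro H
    have hJ : ∀ r l, JJ h l r = - JJ h r l := fun r l => by
      have := congrFun (congrFun H r) l
      simp only [Matrix.add_apply, Matrix.transpose_apply, Matrix.zero_apply] at this
      linarith
    have hd : ∀ r, JJ h r r = 0 := fun r => by linarith [hJ r r]
    refine ⟨fun r => ∑ m, d r m m, ![JJ h 2 1, JJ h 0 2, JJ h 1 0], fun x _ => ?_⟩
    funext r
    show divRow (QF c d h) r x = _
    rw [divRow_QF, Pi.add_apply, cross_apply]
    fin_cases r <;> simp [Fin.sum_univ_three, hd] 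
    · rw [hJ 1 0]; ring
    · rw [hJ 2 1]; ring
    · rw [hJ 0 2]; ring

def Theta : Fin 6 → Fin 3 → ℝ :=
  ![![1, 0, 0], ![0, 1, 0], ![0, 0, 1], ![-1, 1, 0], ![-1, 0, 1], ![0, -1, 1]]

def PP : Fin 6 → M3 :=
  ![!![1, 1, 1; 0, 0, 0; 0, 0, 0], !![0, 0, 0; 1, 1, 1; 0, 0, 0], !![0, 0, 0; 0, 0, 0; 1, 1, 1],
    !![0, -1, 0; 0, 0, 0; 0, 0, 0], !![0, 0, -1; 0, 0, 0; 0, 0, 0], !![0, 0, 0; 0, 0, -1; 0, 0, 0]]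

def SS (e : Fin 6) (w : Fin 3 → ℝ) : M3 := vecMulVec (Theta e) w + vecMulVec w (Theta e)

lemma SS_inj (e : Fin 6) (w : Fin 3 → ℝ) (h : SS e w = 0) : w = 0 := by
  have H : ∀ i j, Theta e i * w j + w i * Theta e j = 0 := fun i j => congrFun (congrFun h i) j
  have h00 := H 0 0
  have h11 := H 1 1
  have h22 := H 2 2
  have h01 := H 0 1
  have h02 := H 0 2
  have h12 := H 1 2
  funext i
  fin_cases e <;> fin_cases i <;> simp [Theta] at h00 h11 h22 h01 h02 h12 ⊢ <;> linarith

def sy (a : Fin 6 → ℝ) : M3 := !![a 0, a 1, a 2; a 1, a 3, a 4; a 2, a 4, a 5]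

lemma sy_symm (a) : (sy a)ᵀ = sy a := by
  ext i j; fin_cases i <;> fin_cases j <;> rfl

lemma sy_surj (M : M3) (h : Mᵀ = M) : sy ![M 0 0, M 0 1, M 0 2, M 1 1, M 1 2, M 2 2] = M := by
  have H : ∀ i j, M j i = M i j := fun i j => congrFun (congrFun h i) j
  ext i j; fin_cases i <;> fin_cases j <;> simp [sy, H 0 1, H 0 2, H 1 2]

lemma sy_inj (a) (h : sy a = 0) : a = 0 := by
  have H : ∀ i j, sy a i j = 0 := fun i j => congrFun (congrFun h i) j
  have h00 := H 0 0
  have h11 := H 1 1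
  have h22 := H 2 2
  have h01 := H 0 1
  have h02 := H 0 2
  have h12 := H 1 2
  simp [sy] at *
  funext i; fin_cases i <;> simp [*]

def phi (e : Fin 6) (z : Fin 3 → ℝ) : ℝ := ∑ n, ∑ l, PP e n l * z n * z l

lemma phi_Theta (e f : Fin 6) : phi e (Theta f) = if e = f then 1 else 0 := by
  fin_cases e <;> fin_cases f <;> simp [phi, PP, Theta, Fin.sum_univ_three]

/-- change of variables in a quadratic form -/
lemma quad_change (h : M3) (A : M3) (z : Fin 3 → ℝ) :
    ∑ n, ∑ l, h n l * (A *ᵥ z) n * (A *ᵥ z) l = ∑ n, ∑ l, (Aᵀ * h * A) n l * z n * z l := by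
  simp only [Matrix.mulVec, dotProduct, Matrix.mul_apply, Matrix.transpose_apply, Fin.sum_univ_three]
  ring

lemma quad_expand0 (h : M3) (z : Fin 3 → ℝ) :
    ∑ n, ∑ l, h n l * z n * z l = ∑ e, phi e z * ∑ n, ∑ l, h n l * Theta e n * Theta e l := by
  simp [phi, PP, Theta, Fin.sum_univ_three, Fin.sum_univ_six]
  ring

lemma HH_expand (h) (A G : M3) (hAG : A * G = 1) (y : Fin 3 → ℝ) :
    HH h y = ∑ e, phi e (G *ᵥ y) • HH h (A *ᵥ Theta e) := by
  have hy : y = A *ᵥ (G *ᵥ y) := by rw [Matrix.mulVec_mulVec, hAG, Matrix.one_mulVec]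
  ext i j
  have : HH h y i j = HH h (A *ᵥ (G *ᵥ y)) i j := by rw [← hy]
  rw [this, Matrix.sum_apply]
  simp only [HH, Matrix.of_apply, Matrix.smul_apply, smul_eq_mul]
  simp only [quad_change (h i j)]
  exact quad_expand0 _ _

def hC (A G : M3) (w : Fin 6 → Fin 3 → ℝ) (i j n l : Fin 3) : ℝ :=
  ∑ e, (Gᵀ * PP e * G) n l * (A * SS e (w e) * Aᵀ) i j

lemma HH_hC (A G : M3) (w) (y : Fin 3 → ℝ) :
    HH (hC A G w) y = ∑ e, phi e (G *ᵥ y) • (A * SS e (w e) * Aᵀ) := by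
  ext i j
  rw [Matrix.sum_apply]
  simp only [HH, hC, Matrix.of_apply, Matrix.smul_apply, smul_eq_mul, phi, quad_change]
  simp only [Finset.sum_mul]
  rw [Finset.sum_comm' (t' := Finset.univ) (s' := fun _ => Finset.univ) (by simp)]
  simp only [Fin.sum_univ_three, Fin.sum_univ_six]
  ring

lemma HH_hC_Theta (A G : M3) (hGA : G * A = 1) (w) (f) :
    HH (hC A G w) (A *ᵥ Theta f) = A * SS f (w f) * Aᵀ := by
  rw [HH_hC, Matrix.mulVec_mulVec, hGA, Matrix.one_mulVec]
  simp [phi_Theta]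

def J0 (w : Fin 6 → Fin 3 → ℝ) : M3 := ∑ e, SS e (w e) * (PP e + (PP e)ᵀ)

lemma JJ_hC (A G : M3) (hGA : G * A = 1) (w) : JJ (hC A G w) = A * J0 w * G := by
  have hT : Aᵀ * Gᵀ = 1 := by rw [← Matrix.transpose_mul, hGA, Matrix.transpose_one]
  have h1 : JJ (hC A G w) = ∑ e, (A * SS e (w e) * Aᵀ) * (Gᵀ * (PP e + (PP e)ᵀ) * G) := by
    ext r l
    have hs : ∀ e, (Gᵀ * (PP e + (PP e)ᵀ) * G) = (Gᵀ * PP e * G) + (Gᵀ * PP e * G)ᵀ := by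
      intro e
      simp [Matrix.mul_add, Matrix.add_mul, Matrix.transpose_mul, Matrix.mul_assoc]
    rw [Matrix.sum_apply]
    simp only [hs, JJ, hC, Matrix.of_apply]
    simp only [Matrix.mul_apply (M := A * _ * _), Matrix.add_apply, Matrix.transpose_apply]
    rw [Finset.sum_comm]
    refine Finset.sum_congr rfl fun m _ => ?_
    rw [← Finset.sum_add_distrib]
    refine Finset.sum_congr rfl fun e _ => ?_
    ring
  rw [h1, J0, Matrix.mul_sum, Matrix.sum_mul]
  refine Finset.sum_congr rfl fun e _ => ?_
  calc _ = A * SS e (w e) * (Aᵀ * Gᵀ) * (PP e + (PP e)ᵀ) * G := by simp only [Matrix.mul_assoc]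
    _ = _ := by rw [hT]; simp only [Matrix.mul_one, Matrix.mul_assoc]

/-- A right inverse of `J0`. -/
def wsol (M : M3) : Fin 6 → Fin 3 → ℝ :=
  ![![0, (3/5)*M 0 0 + (1/5)*M 1 0 + (-1/5)*M 1 1 + (1/5)*M 1 2 + (-3/5)*M 2 2, M 2 1],
    ![0, (-1/4)*M 0 0 + (1/4)*M 1 1 + (1/4)*M 2 2, 0],
    ![(1/5)*M 0 1 + (1/5)*M 0 2 + (1/5)*M 2 0 + (-4/5)*M 2 1 + (2/5)*M 2 2, 0, 0],
    ![0, (2/5)*M 0 0 + (-1/5)*M 1 0 + (1/5)*M 1 1 + (-1/5)*M 1 2 + (-2/5)*M 2 2, 0],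
    ![(1/5)*M 0 1 + (1/5)*M 0 2 + (-3/10)*M 2 0 + (6/5)*M 2 1 + (-3/5)*M 2 2,
      (-1/10)*M 0 0 + (-1/5)*M 1 0 + (-3/10)*M 1 1 + (4/5)*M 1 2 + (1/10)*M 2 2,
      (-1/2)*M 2 0 + M 2 1],
    ![(-4/5)*M 0 1 + (1/5)*M 0 2 + (1/5)*M 2 0 + (-4/5)*M 2 1 + (2/5)*M 2 2, 0, 0]]

lemma J0_wsol (M : M3) : J0 (wsol M) = M := by
  ext i j
  simp only [J0, Matrix.sum_apply, Matrix.mul_apply, Fin.sum_univ_three, Fin.sum_univ_six, SS,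
    vecMulVec_apply, Matrix.add_apply, Matrix.transpose_apply]
  fin_cases i <;> fin_cases j <;> simp [Theta, PP, wsol] <;> ring

lemma SS_add (e a b) : SS e (a + b) = SS e a + SS e b := by
  ext i j; simp [SS, vecMulVec_apply]; ring
lemma SS_smul (e) (r : ℝ) (a) : SS e (r • a) = r • SS e a := by
  ext i j; simp [SS, vecMulVec_apply]; ring
lemma sy_add (a b) : sy (a + b) = sy a + sy b := by
  ext i j; fin_cases i <;> fin_cases j <;> simp [sy]
lemma sy_smul (r : ℝ) (a) : sy (r • a) = r • sy a := by
  ext i j; fin_cases i <;> fin_cases j <;> simp [sy]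

lemma hC_add (A G a b) : hC A G (a + b) = hC A G a + hC A G b := by
  funext i j n l
  simp [hC, SS_add, Matrix.mul_add, Matrix.add_mul, Finset.sum_add_distrib, mul_add]
lemma hC_smul (A G) (r : ℝ) (a) : hC A G (r • a) = r • hC A G a := by
  funext i j n l
  simp only [hC, Pi.smul_apply, SS_smul, Matrix.mul_smul, Matrix.smul_mul, Matrix.smul_apply,
    smul_eq_mul, Finset.mul_sum]
  exact Finset.sum_congr rfl fun e _ => by ring

abbrev VV := (Fin 4 → Fin 6 → ℝ) × (Fin 6 → Fin 3 → ℝ)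

def dC (z : VV) (i j n : Fin 3) : ℝ := sy (z.1 n.succ) i j

def Phi (A G : M3) : VV →ₗ[ℝ] (E3 → M3) where
  toFun z := QF (sy (z.1 0)) (dC z) (hC A G z.2)
  map_add' a b := by
    funext x; ext i j
    simp only [QF, qf, dC, Prod.fst_add, Prod.snd_add, hC_add, sy_add, Pi.add_apply,
      Matrix.add_apply, Matrix.of_apply, add_mul, Finset.sum_add_distrib]
    ring
  map_smul' r a := by
    funext x; ext i j
    simp only [QF, qf, dC, Prod.smul_fst, Prod.smul_snd, hC_smul, sy_smul, Pi.smul_apply,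
      Matrix.smul_apply, Matrix.of_apply, smul_eq_mul, RingHom.id_apply, mul_add, Finset.mul_sum]
    simp only [mul_assoc]

def pick (M : M3) : Fin 6 → ℝ := ![M 0 0, M 0 1, M 0 2, M 1 1, M 1 2, M 2 2]

lemma J0_add (a b) : J0 (a + b) = J0 a + J0 b := by
  simp only [J0, Pi.add_apply, SS_add, Matrix.add_mul, Finset.sum_add_distrib]

lemma J0_smul (r : ℝ) (a) : J0 (r • a) = r • J0 a := by
  simp only [J0, Pi.smul_apply, SS_smul, Matrix.smul_mul, Finset.smul_sum]

lemma pick_add (M N) : pick (M + N) = pick M + pick N := by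
  funext e; fin_cases e <;> simp [pick]
lemma pick_smul (r : ℝ) (M) : pick (r • M) = r • pick M := by
  funext e; fin_cases e <;> simp [pick]
lemma pick_sy (a) : pick (sy a) = a := by
  funext e; fin_cases e <;> simp [pick, sy]

def Psi (A G : M3) : VV →ₗ[ℝ] (Fin 6 → ℝ) where
  toFun z := pick (A * J0 z.2 * G + (A * J0 z.2 * G)ᵀ)
  map_add' a b := by
    simp only [Prod.snd_add, J0_add, Matrix.mul_add, Matrix.add_mul, Matrix.transpose_add, pick_add]
    abel
  map_smul' r a := by
    simp only [Prod.smul_snd, J0_smul, Matrix.mul_smul, Matrix.smul_mul, Matrix.transpose_smul,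
      pick_smul, pick_add, RingHom.id_apply, smul_add]

lemma Psi_surj (A G : M3) (hAG : A * G = 1) : Function.Surjective (Psi A G) := by
  intro R
  have hGA : G * A = 1 := mul_eq_one_comm.1 hAG
  refine ⟨(0, wsol (G * ((1/2 : ℝ) • sy R) * A)), ?_⟩
  show pick _ = R
  have : A * (G * ((1/2 : ℝ) • sy R) * A) * G = (1/2 : ℝ) • sy R := by
    calc _ = (A * G) * ((1/2 : ℝ) • sy R) * (A * G) := by simp only [Matrix.mul_assoc]
      _ = _ := by rw [hAG, Matrix.one_mul, Matrix.mul_one]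
  rw [J0_wsol, this, Matrix.transpose_smul, sy_symm, ← add_smul]
  norm_num
  exact pick_sy R

lemma Psi_zero (A G : M3) (z) : Psi A G z = 0 ↔ A * J0 z.2 * G + (A * J0 z.2 * G)ᵀ = 0 := by
  have hs : (A * J0 z.2 * G + (A * J0 z.2 * G)ᵀ)ᵀ = A * J0 z.2 * G + (A * J0 z.2 * G)ᵀ := by
    rw [Matrix.transpose_add, Matrix.transpose_transpose, add_comm]
  have := sy_surj _ hs
  constructor
  · intro h
    rw [← this]
    change sy (Psi A G z) = 0
    rw [h]
    ext i j; fin_cases i <;> fin_cases j <;> simp [sy]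
  · intro h
    show pick _ = 0
    rw [h]
    funext e; fin_cases e <;> simp [pick]

lemma QF_coeff (c d h) (h0 : ∀ x, QF c d h x = 0) :
    c = 0 ∧ d = 0 ∧ ∀ y, HH h y = 0 := by
  have H := fun i j => qf_coeff (c i j) (d i j) (h i j) (fun x => congrFun (congrFun (h0 x) i) j)
  refine ⟨?_, ?_, fun y => ?_⟩
  · ext i j; exact (H i j).1
  · funext i j; exact (H i j).2.1
  · ext i j; exact (H i j).2.2 y

lemma conj_zero (A G M : M3) (hGA : G * A = 1) (h : A * M * Aᵀ = 0) : M = 0 := by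
  have hT : Aᵀ * Gᵀ = 1 := by rw [← Matrix.transpose_mul, hGA, Matrix.transpose_one]
  calc M = (G * A) * M * (Aᵀ * Gᵀ) := by rw [hGA, hT, Matrix.one_mul, Matrix.mul_one]
    _ = G * (A * M * Aᵀ) * Gᵀ := by simp only [Matrix.mul_assoc]
    _ = 0 := by rw [h]; simp

lemma Phi_inj (A G : M3) (hGA : G * A = 1) : Function.Injective (Phi A G) := by
  rw [← LinearMap.ker_eq_bot, LinearMap.ker_eq_bot']
  intro z hz
  obtain ⟨h1, h2, h3⟩ := QF_coeff _ _ _ (fun x => congrFun hz x)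
  have hw : z.2 = 0 := by
    funext e
    have := h3 (A *ᵥ Theta e)
    rw [HH_hC_Theta A G hGA] at this
    exact SS_inj e _ (conj_zero A G _ hGA this)
  have hc : z.1 = 0 := by
    funext n
    refine Fin.cases ?_ (fun n => ?_) n
    · exact sy_inj _ h1
    · apply sy_inj
      ext i j
      exact congrFun (congrFun (congrFun h2 i) j) n
  exact Prod.ext hc hw

lemma QF_symm_of (c d h) (h0 : ∀ x, (QF c d h x).IsSymm) :
    cᵀ = c ∧ (∀ i j, d j i = d i j) ∧ ∀ y, (HH h y)ᵀ = HH h y := by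
  have H := fun i j => qf_coeff (c j i - c i j) (d j i - d i j) (h j i - h i j) (fun x => by
    have := congrFun (congrFun (h0 x) i) j
    simp only [QF, Matrix.transpose_apply, Matrix.of_apply] at this
    unfold qf at *
    simp only [Pi.sub_apply, sub_mul, Finset.sum_sub_distrib]
    linarith)
  refine ⟨?_, fun i j => sub_eq_zero.1 (H i j).2.1, fun y => ?_⟩
  · ext i j; exact sub_eq_zero.1 (H i j).1
  · ext i j
    have := (H i j).2.2 y
    simp only [Pi.sub_apply, sub_mul, Finset.sum_sub_distrib] at this
    exact sub_eq_zero.1 this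

lemma symm_on_tet (v : Fin 4 → E3) (hv : AffineIndependent ℝ v) (c d h)
    (h0 : ∀ x ∈ Tet v, (QF c d h x).IsSymm) : ∀ x, (QF c d h x).IsSymm := by
  intro x
  ext i j
  have := qf_zero_of_tet v hv (c j i - c i j) (d j i - d i j) (h j i - h i j) (fun x hx => by
    have := congrFun (congrFun (h0 x hx) i) j
    simp only [QF, Matrix.transpose_apply, Matrix.of_apply] at this
    unfold qf at *
    simp only [Pi.sub_apply, sub_mul, Finset.sum_sub_distrib]
    linarith) x
  simp only [QF, Matrix.transpose_apply, Matrix.of_apply]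
  unfold qf at *
  simp only [Pi.sub_apply, sub_mul, Finset.sum_sub_distrib] at this
  linarith

def AA (v : Fin 4 → E3) : M3 := Matrix.of fun i j => (v j.succ - v 0) i

lemma AA_inv (v : Fin 4 → E3) (hv : AffineIndependent ℝ v) : AA v * (AA v)⁻¹ = 1 := by
  apply Matrix.mul_nonsing_inv
  rw [← Matrix.isUnit_iff_isUnit_det, ← Matrix.linearIndependent_cols_iff_isUnit]
  rw [affineIndependent_iff_linearIndependent_vsub ℝ v 0] at hv
  have h2 := hv.comp (fun j : Fin 3 => (⟨j.succ, Fin.succ_ne_zero j⟩ : {x : Fin 4 // x ≠ 0}))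
    (fun a b hab => by simpa using hab)
  have h3 := h2.map' (WithLp.linearEquiv 2 ℝ (Fin 3 → ℝ)).toLinearMap (LinearEquiv.ker _)
  exact h3

def ek : Fin 6 → Fin 4 := ![0, 0, 0, 1, 1, 2]
def el : Fin 6 → Fin 4 := ![1, 2, 3, 2, 3, 3]

lemma ek_ne (e) : ek e ≠ el e := by fin_cases e <;> decide

lemma edge_vec (v : Fin 4 → E3) (e : Fin 6) :
    (fun i => (v (el e) - v (ek e)) i) = AA v *ᵥ Theta e := by
  funext i
  fin_cases e <;>
    simp [ek, el, AA, Theta, Matrix.mulVec, dotProduct, Fin.sum_univ_three, Fin.succ]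

lemma edge_cases : ∀ k l : Fin 4, k ≠ l → ∃ e, (k = ek e ∧ l = el e) ∨ (k = el e ∧ l = ek e) := by
  decide

lemma HH_neg (h y) : HH h (-y) = HH h y := by
  ext i j; simp [HH]

lemma mem_bwd (v : Fin 4 → E3) (hv : AffineIndependent ℝ v) (c d h)
    (h1 : ∀ x, (QF c d h x).IsSymm)
    (h2 : ∀ e, ∃ u, HH h (AA v *ᵥ Theta e) = vecMulVec (AA v *ᵥ Theta e) u
      + vecMulVec u (AA v *ᵥ Theta e))
    (h3 : JJ h + (JJ h)ᵀ = 0) : MemSigmaTildeK v (QF c d h) := by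
  refine ⟨⟨fun i j => qf_isPoly _ _ _, fun x _ => h1 x, ?_⟩, (rigid_iff v hv c d h).2 h3⟩
  intro k l hkl s hs ht
  refine edge_bwd c d h _ _ (fun h => hkl (hv.injective h)) s hs ht ?_
  obtain ⟨e, ⟨rfl, rfl⟩ | ⟨rfl, rfl⟩⟩ := edge_cases k l hkl
  · rw [edge_vec]; exact h2 e
  · have : (fun i => (v (ek e) - v (el e)) i) = - (AA v *ᵥ Theta e) := by
      rw [← edge_vec]; funext i; simp
    rw [this, HH_neg]
    obtain ⟨u, hu⟩ := h2 e
    refine ⟨-u, ?_⟩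
    rw [hu]
    ext i j
    simp [vecMulVec_apply]

lemma mem_fwd (v : Fin 4 → E3) (hv : AffineIndependent ℝ v) (c d h)
    (H : MemSigmaTildeK v (QF c d h)) : 
    (∀ x, (QF c d h x).IsSymm) ∧
    (∀ e, ∃ u, HH h (AA v *ᵥ Theta e) = vecMulVec (AA v *ᵥ Theta e) u
      + vecMulVec u (AA v *ᵥ Theta e)) ∧ JJ h + (JJ h)ᵀ = 0 := by
  obtain ⟨⟨-, hs, he⟩, hr⟩ := H
  have hs' := symm_on_tet v hv c d h hs
  refine ⟨hs', fun e => ?_, (rigid_iff v hv c d h).1 hr⟩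
  rw [← edge_vec]
  have hne : v (ek e) ≠ v (el e) := fun h => ek_ne e (hv.injective h)
  have hn : ‖v (el e) - v (ek e)‖ ≠ 0 := norm_ne_zero_iff.2 (sub_ne_zero.2 hne.symm)
  have hc : v (el e) - v (ek e) = ‖v (el e) - v (ek e)‖ •
      (‖v (el e) - v (ek e)‖⁻¹ • (v (el e) - v (ek e))) := by
    rw [smul_smul, mul_inv_cancel₀ hn, one_smul]
  refine edge_fwd c d h _ _ hne _ ⟨_, hc⟩ ((QF_symm_of c d h hs').2.2 _)
    (he _ _ (ek_ne e) _ ?_ ⟨_, hc⟩)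
  rw [norm_smul, norm_inv, norm_norm, inv_mul_cancel₀ hn]

lemma vmv_conj (A : M3) (e w) :
    A * SS e w * Aᵀ = vecMulVec (A *ᵥ Theta e) (A *ᵥ w) + vecMulVec (A *ᵥ w) (A *ᵥ Theta e) := by
  simp only [SS, Matrix.mul_add, Matrix.add_mul, Matrix.mul_vecMulVec, Matrix.vecMulVec_mul,
    Matrix.vecMul_transpose]

lemma SS_symm (e w) : (SS e w)ᵀ = SS e w := by
  simp [SS, Matrix.transpose_vecMulVec, add_comm]

lemma hC_symm (A G w i j) : hC A G w i j = hC A G w j i := by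
  funext n l
  simp only [hC]
  refine Finset.sum_congr rfl fun e _ => ?_
  have : (A * SS e (w e) * Aᵀ)ᵀ = A * SS e (w e) * Aᵀ := by
    simp [Matrix.transpose_mul, SS_symm, Matrix.mul_assoc]
  rw [← congrFun (congrFun this i) j, Matrix.transpose_apply]

lemma Phi_mem (v : Fin 4 → E3) (hv : AffineIndependent ℝ v) (z : VV)
    (hz : Psi (AA v) (AA v)⁻¹ z = 0) : MemSigmaTildeK v (Phi (AA v) (AA v)⁻¹ z) := by
  have hAG := AA_inv v hv
  have hGA := mul_eq_one_comm.1 hAG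
  refine mem_bwd v hv _ _ _ ?_ ?_ ?_
  · intro x
    ext i j
    have h1 : ∀ a, sy a j i = sy a i j := fun a => congrFun (congrFun (sy_symm a) i) j
    have h2 : dC z j i = dC z i j := funext fun n => h1 _
    simp only [QF, Matrix.transpose_apply, Matrix.of_apply]
    rw [h1, h2, hC_symm]
  · intro e
    rw [HH_hC_Theta _ _ hGA, vmv_conj]
    exact ⟨_, rfl⟩
  · rw [JJ_hC _ _ hGA]
    exact (Psi_zero _ _ _).1 hz

lemma mem_Phi (v : Fin 4 → E3) (hv : AffineIndependent ℝ v) (τ : E3 → M3)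
    (hτ : MemSigmaTildeK v τ) : ∃ z, Psi (AA v) (AA v)⁻¹ z = 0 ∧ Phi (AA v) (AA v)⁻¹ z = τ := by
  have hAG := AA_inv v hv
  have hGA := mul_eq_one_comm.1 hAG
  have hex := fun i j => isPoly_qf _ (hτ.1.1 i j)
  choose c d h hq using hex
  have : τ = QF c d h := by
    funext x; ext i j; exact congrFun (hq i j) x
  subst this
  obtain ⟨hs, he, hJ⟩ := mem_fwd v hv c d h hτ
  choose u hu using he
  obtain ⟨sc, sd, -⟩ := QF_symm_of c d h hs
  let z : VV := (Fin.cons (pick c) (fun n => pick (Matrix.of fun i j => d i j n)),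
    fun e => (AA v)⁻¹ *ᵥ u e)
  have hH : ∀ y, HH (hC (AA v) (AA v)⁻¹ z.2) y = HH h y := by
    intro y
    rw [HH_hC, HH_expand h _ _ hAG]
    refine Finset.sum_congr rfl fun e _ => ?_
    rw [hu, vmv_conj]
    simp only [z, Matrix.mulVec_mulVec, hAG, Matrix.one_mulVec]
  have hΦ : Phi (AA v) (AA v)⁻¹ z = QF c d h := by
    funext x
    ext i j
    have e1 : sy (z.1 0) = c := sy_surj c sc
    have e2 : dC z i j = d i j := by
      funext n
      have := sy_surj (Matrix.of fun i j => d i j n) (by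
        ext i j; exact congrFun (sd i j) n)
      exact congrFun (congrFun this i) j
    have e3 := congrFun (congrFun (hH (fun i => x i)) i) j
    show qf (sy (z.1 0) i j) (dC z i j) (hC (AA v) (AA v)⁻¹ z.2 i j) x = qf _ _ _ x
    rw [e1, e2]
    unfold qf
    congr 1
  refine ⟨z, ?_, hΦ⟩
  rw [Psi_zero, ← JJ_hC _ _ hGA]
  rw [← hΦ] at hτ
  exact (mem_fwd v hv _ _ _ hτ).2.2

/-- The reduced space `Σ̃_K` has dimension exactly 36: it admits a basis of 36
elements, i.e. a linearly independent family of 36 members of `Σ̃_K` whose span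
contains all of `Σ̃_K`. -/
theorem stmt_14 (v : Fin 4 → E3) (hv : AffineIndependent ℝ v) :
    ∃ B : Fin 36 → (E3 → Matrix (Fin 3) (Fin 3) ℝ),
      (∀ m, MemSigmaTildeK v (B m)) ∧
      LinearIndependent ℝ B ∧
      ∀ τ : E3 → Matrix (Fin 3) (Fin 3) ℝ, MemSigmaTildeK v τ →
        τ ∈ Submodule.span ℝ (Set.range B) := by
  have hAG := AA_inv v hv
  have hGA := mul_eq_one_comm.1 hAG
  have hdim : Module.finrank ℝ (LinearMap.ker (Psi (AA v) (AA v)⁻¹)) = 36 := by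
    have h1 := LinearMap.finrank_range_add_finrank_ker (Psi (AA v) (AA v)⁻¹)
    rw [LinearMap.range_eq_top.2 (Psi_surj _ _ hAG), finrank_top] at h1
    have h2 : Module.finrank ℝ VV = 42 := by
      simp [VV, Module.finrank_pi_fintype]
    rw [h2] at h1
    simp at h1
    omega
  let b := Module.finBasisOfFinrankEq ℝ _ hdim
  let F := (Phi (AA v) (AA v)⁻¹).comp (LinearMap.ker (Psi (AA v) (AA v)⁻¹)).subtype
  have hF : Function.Injective F := (Phi_inj _ _ hGA).comp Subtype.val_injective
  refine ⟨fun m => F (b m), fun m => Phi_mem v hv _ (b m).2, ?_, ?_⟩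
  · exact b.linearIndependent.map' F (LinearMap.ker_eq_bot.2 hF)
  · intro τ hτ
    obtain ⟨z, hz, rfl⟩ := mem_Phi v hv τ hτ
    have : Set.range (fun m => F (b m)) = F '' Set.range b := by
      rw [← Set.range_comp]; rfl
    rw [this, Submodule.span_image, b.span_eq]
    exact ⟨⟨z, hz⟩, trivial, rfl⟩
end
end
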